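/- arXiv:2306.04005 — 2 statements merged into one kernel-verified Lean document; each statement's English description precedes it below -/
import Mathlib

section
/- Let T be a tree on n vertices with distance matrix D and a fixed vertex 1, and let R(T) = 2(n−1)·1^T D e_1 − 1^T D 1. Then 0 ≤ R(T) ≤ (2/3)·n(n−1)(n−2). -/
theorem aux_level {V : Type*} (G : SimpleGraph V) (hc : G.Connected) (v a : V) (j : ℕ)
    (hj : j ≤ G.dist a v) : ∃ w, G.dist w v = j := by
  obtain ⟨p, hp⟩ := hc.exists_walk_length_eq_dist v a
  rw [SimpleGraph.dist_comm] at hj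
  refine ⟨p.getVert j, ?_⟩
  have h1 := SimpleGraph.dist_le (p.take j)
  have h2 := SimpleGraph.dist_le (p.drop j)
  have h3 := hc.dist_triangle (u := v) (v := p.getVert j) (w := a)
  rw [SimpleGraph.Walk.take_length] at h1
  rw [SimpleGraph.Walk.drop_length] at h2
  rw [SimpleGraph.dist_comm]
  omega

theorem aux_min (n x y : ℕ) (hx : x < n) :
    ((min x y : ℕ) : ℚ) = ∑ k ∈ Finset.range n, (if k < x then (1:ℚ) else 0) * (if k < y then 1 else 0) := by
  have : ∀ k, (if k < x then (1:ℚ) else 0) * (if k < y then 1 else 0)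
      = if k < min x y then 1 else 0 := by
    intro k
    by_cases h1 : k < x <;> by_cases h2 : k < y <;> simp [h1, h2]
  simp only [this]
  rw [Finset.sum_boole]
  congr 1
  have : (Finset.range n).filter (fun k => k < min x y) = Finset.range (min x y) := by
    ext k; simp only [Finset.mem_filter, Finset.mem_range]; omega
  rw [this, Finset.card_range]

theorem aux_sum (n : ℕ) : ∑ k ∈ Finset.range n, ((n:ℚ) - 1 - k) * ((n:ℚ) - 1 - k - 1)
    = (1/3) * n * (n-1) * (n-2) := by
  induction n with
  | zero => simp
  | succ m ih =>
    rw [Finset.sum_range_succ']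
    have : ∀ k : ℕ, (((m+1 : ℕ):ℚ) - 1 - ((k+1 : ℕ) : ℚ)) * (((m+1 : ℕ):ℚ) - 1 - ((k+1:ℕ):ℚ) - 1)
       = ((m:ℚ) - 1 - k) * ((m:ℚ) - 1 - k - 1) := by
      intro k; push_cast; ring
    simp only [this]
    rw [ih]; push_cast; ring

theorem R_bounds (n : ℕ) {V : Type*} [Fintype V]
    (G : SimpleGraph V) (hT : G.IsTree) (hn : Fintype.card V = n) (v : V) :
    0 ≤ 2 * ((n : ℚ) - 1) * (∑ a : V, (G.dist a v : ℚ))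
          - (∑ a : V, ∑ b : V, (G.dist a b : ℚ)) ∧
    2 * ((n : ℚ) - 1) * (∑ a : V, (G.dist a v : ℚ))
          - (∑ a : V, ∑ b : V, (G.dist a b : ℚ))
      ≤ (2 / 3) * (n : ℚ) * ((n : ℚ) - 1) * ((n : ℚ) - 2) := by
  classical
  have hc : G.Connected := hT.1
  set f : V → ℕ := fun a => G.dist a v with hf
  -- rewriting
  have key : 2 * ((n : ℚ) - 1) * (∑ a : V, (G.dist a v : ℚ))
          - (∑ a : V, ∑ b : V, (G.dist a b : ℚ))
      = ∑ a : V, ∑ b : V, ((f a : ℚ) + f b - (if a = b then 2 * (f a : ℚ) else 0) - G.dist a b) := by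
    simp only [Finset.sum_sub_distrib, Finset.sum_add_distrib, Finset.sum_const, Finset.card_univ,
      hn, nsmul_eq_mul, Finset.sum_ite_eq, Finset.mem_univ, if_true, ← Finset.mul_sum]
    simp only [hf]
    ring
  rw [key]
  constructor
  · refine Finset.sum_nonneg fun a _ => Finset.sum_nonneg fun b _ => ?_
    by_cases h : a = b
    · subst h; simp; linarith
    · have h3 := hc.dist_triangle (u := a) (v := v) (w := b)
      rw [SimpleGraph.dist_comm (u := v)] at h3
      have : (G.dist a b : ℚ) ≤ f a + f b := by exact_mod_cast h3
      simp only [h, if_false]; linarith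
  · have hlow : ∀ a, ∀ k, k < f a → k + 1 ≤ (Finset.univ.filter (fun w => ¬ k < f w)).card := by
      intro a k hk
      have : Finset.range (k+1) ⊆ (Finset.univ.filter (fun w => ¬ k < f w)).image f := by
        intro j hj
        rw [Finset.mem_range] at hj
        obtain ⟨w, hw⟩ := aux_level G hc v a j (by simp only [hf] at hk; omega)
        have hw' : f w = j := hw
        rw [Finset.mem_image]
        refine ⟨w, ?_, hw'⟩
        simp; omega
      have h := (Finset.card_le_card this).trans Finset.card_image_le
      simpa using h
    have hcard : ∀ k, (Finset.univ.filter (fun w => k < f w)).card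
        + (Finset.univ.filter (fun w => ¬ k < f w)).card = n := by
      intro k
      rw [Finset.card_filter_add_card_filter_not, Finset.card_univ, hn]
    have hfn : ∀ a, f a < n := by
      intro a
      rcases Nat.eq_zero_or_pos (f a) with h | h
      · rw [h, ← hn]; exact Fintype.card_pos_iff.mpr ⟨v⟩
      · have h1 := hlow a (f a - 1) (by omega)
        have h2 := hcard (f a - 1)
        have h3 : 0 < (Finset.univ.filter (fun w => f a - 1 < f w)).card :=
          Finset.card_pos.mpr ⟨a, by simp; omega⟩
        omega
    set N : ℕ → ℚ := fun k => ∑ a, (if k < f a then (1:ℚ) else 0) with hN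
    have hNb : ∀ k ∈ Finset.range n, N k * (N k - 1) ≤ ((n:ℚ) - 1 - k) * ((n:ℚ) - 1 - k - 1) := by
      intro k hk
      rw [Finset.mem_range] at hk
      have hNc : N k = ((Finset.univ.filter (fun w => k < f w)).card : ℚ) := by
        simp only [hN, Finset.sum_boole]
      rcases Nat.eq_zero_or_pos (Finset.univ.filter (fun w => k < f w)).card with h | h
      · rw [hNc, h]
        obtain ⟨m, rfl⟩ : ∃ m, n = k + 1 + m := ⟨n - (k+1), by omega⟩
        push_cast
        rcases m with _ | m
        · simp
        · push_cast
          have : (0:ℚ) ≤ m := by positivity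
          nlinarith
      · obtain ⟨a, ha⟩ := Finset.card_pos.mp h
        have h1 := hlow a k (by simpa using ha)
        have h2 := hcard k
        have h4 : (Finset.univ.filter (fun w => k < f w)).card + (k + 1) ≤ n := by omega
        have h5 : N k + (k + 1) ≤ n := by rw [hNc]; exact_mod_cast h4
        have h6 : 1 ≤ N k := by rw [hNc]; exact_mod_cast h
        nlinarith
    have hff : ∀ a, (f a : ℚ) = ∑ k ∈ Finset.range n, (if k < f a then (1:ℚ) else 0) := by
      intro a
      have := aux_min n (f a) (f a) (hfn a)
      rw [min_self] at this
      rw [this]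
      refine Finset.sum_congr rfl fun k _ => ?_
      split_ifs <;> simp
    have h1 : ∑ a : V, (f a : ℚ) = ∑ k ∈ Finset.range n, N k := by
      simp only [hN]
      rw [Finset.sum_comm]
      exact Finset.sum_congr rfl fun a _ => hff a
    have h2 : ∑ a : V, ∑ b : V, ((min (f a) (f b) : ℕ) : ℚ) = ∑ k ∈ Finset.range n, N k * N k := by
      simp only [hN, Finset.sum_mul_sum]
      symm
      rw [Finset.sum_comm]
      refine Finset.sum_congr rfl fun a _ => ?_
      rw [Finset.sum_comm]
      exact Finset.sum_congr rfl fun b _ => (aux_min n _ _ (hfn a)).symm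
    calc _ ≤ ∑ a : V, ∑ b : V, (2 * ((min (f a) (f b) : ℕ) : ℚ) - (if a = b then 2 * (f a : ℚ) else 0)) := by
          refine Finset.sum_le_sum fun a _ => Finset.sum_le_sum fun b _ => ?_
          have t1 := hc.dist_triangle (u := a) (v := b) (w := v)
          have t2 := hc.dist_triangle (u := b) (v := a) (w := v)
          rw [SimpleGraph.dist_comm (u := b) (v := a)] at t2
          have : f a + f b ≤ 2 * min (f a) (f b) + G.dist a b := by
            simp only [hf]; omega
          have : (f a : ℚ) + f b ≤ 2 * ((min (f a) (f b) : ℕ) : ℚ) + G.dist a b := by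
            exact_mod_cast this
          linarith
      _ = 2 * ∑ k ∈ Finset.range n, N k * (N k - 1) := by
          simp only [Finset.sum_sub_distrib, Finset.sum_ite_eq, Finset.mem_univ, if_true,
            ← Finset.mul_sum, mul_sub, mul_one]
          rw [h1, h2]
      _ ≤ 2 * ∑ k ∈ Finset.range n, ((n:ℚ) - 1 - k) * ((n:ℚ) - 1 - k - 1) := by
          have := Finset.sum_le_sum hNb
          linarith
      _ = _ := by rw [aux_sum]; ring
end

section
/- Let G be a unicyclic graph obtained from a tree T by adding the edge v_1 v_c, where v_1, v_2, …, v_c is the path in T joining v_1 and v_c. For vertices a in branch T_j and b in branch T_k (the subtrees hanging off the cycle at v_j and v_k), the number σ(a,b) of spanning forests of G consisting of exactly two trees, one containing a and the other containing b, satisfies σ(a,b) = c·d_T(a,b) − (j−k)², where d_T is the distance in T. -/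
/-- The number of spanning forests of `G` consisting of exactly two trees, one
containing `a` and the other containing `b`: subgraphs of `G` (on the full vertex
set) that are acyclic, have exactly two connected components, and in which `a`
and `b` are not connected to each other. -/
noncomputable def twoTreeForestCount {V : Type*} (G : SimpleGraph V) (a b : V) : ℕ :=
  Set.ncard {H : SimpleGraph V | H ≤ G ∧ H.IsAcyclic ∧
    Nat.card H.ConnectedComponent = 2 ∧ ¬ H.Reachable a b}

open SimpleGraph

lemma tf_exists_side {V : Type*} (T : SimpleGraph V) (hT : T.IsTree) :
    ∃ s : Sym2 V → V → Bool, ∀ f u v, T.Adj u v → (s f u ≠ s f v ↔ f = s(u, v)) := by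
  classical
  refine ⟨fun f z => decide ((T.deleteEdges {f}).Reachable z f.out.1), fun f u v huv => ?_⟩
  by_cases hf : f = s(u, v)
  · have hb : ¬ (T.deleteEdges {f}).Reachable u v := by
      subst hf
      exact (isAcyclic_iff_forall_adj_isBridge.mp hT.isAcyclic huv)
    have ho : f.out.1 ∈ f := Sym2.out_fst_mem f
    have ho' : f.out.1 = u ∨ f.out.1 = v := by
      rw [hf] at ho ⊢
      simpa using ho
    simp only [hf, iff_true]
    rw [← hf]
    rcases ho' with h | h
    · rw [h]
      have : ¬ (T.deleteEdges {f}).Reachable v u := fun h' => hb h'.symm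
      simp [this]
    · rw [h]
      simp [hb]
  · simp only [hf, iff_false, not_not]
    have hadj : (T.deleteEdges {f}).Adj u v := by
      rw [deleteEdges_adj]
      exact ⟨huv, by simpa using fun h => hf h.symm⟩
    rw [decide_eq_decide]
    exact ⟨fun h => hadj.symm.reachable.trans h, fun h => hadj.reachable.trans h⟩

/-- The edges separating `x` and `y`. -/
def tfD {V : Type*} (s : Sym2 V → V → Bool) (x y : V) : Set (Sym2 V) := {f | s f x ≠ s f y}

lemma tfD_walk {V : Type*} (T : SimpleGraph V) (s : Sym2 V → V → Bool)
    (hs : ∀ f u v, T.Adj u v → (s f u ≠ s f v ↔ f = s(u, v))) {x y : V} (p : T.Walk x y)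
    (hp : p.IsTrail) : ∀ f, f ∈ tfD s x y ↔ f ∈ p.edges := by
  induction p with
  | nil => intro f; simp [tfD]
  | @cons u v z h q ih =>
    intro f
    rw [Walk.isTrail_cons] at hp
    have h1 := ih hp.1 f
    have h2 := hs f u v h
    simp only [tfD, Set.mem_ofPred_eq, Walk.edges_cons, List.mem_cons] at h1 ⊢
    by_cases hf : f = s(u, v)
    · have h3 : f ∉ q.edges := hf ▸ hp.2
      have h4 := h2.mpr hf
      simp only [hf, true_or, iff_true]
      rw [← hf]
      have h5 : s f v = s f z := by
        by_contra h6
        exact h3 (h1.mp h6)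
      rwa [← h5]
    · have : s f u = s f v := by
        by_contra h6
        exact hf (h2.mp h6)
      rw [this, h1]
      simp [hf]

lemma tfD_sub {V : Type*} (T : SimpleGraph V) (hT : T.IsTree) (s : Sym2 V → V → Bool)
    (hs : ∀ f u v, T.Adj u v → (s f u ≠ s f v ↔ f = s(u, v))) (x y : V) :
    tfD s x y ⊆ T.edgeSet := by
  obtain ⟨p, hp, hl⟩ := hT.connected.exists_path_of_dist x y
  intro f hf
  exact p.edges_subset_edgeSet ((tfD_walk T s hs p hp.isTrail f).mp hf)

lemma tfD_card {V : Type*} (T : SimpleGraph V) (hT : T.IsTree) (s : Sym2 V → V → Bool)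
    (hs : ∀ f u v, T.Adj u v → (s f u ≠ s f v ↔ f = s(u, v))) (x y : V) :
    (tfD s x y).ncard = T.dist x y := by
  classical
  obtain ⟨p, hp, hl⟩ := hT.connected.exists_path_of_dist x y
  have : tfD s x y = (p.edges.toFinset : Set (Sym2 V)) := by
    ext f
    simpa using tfD_walk T s hs p hp.isTrail f
  rw [this, Set.ncard_coe_finset, List.toFinset_card_of_nodup hp.isTrail.edges_nodup,
    Walk.length_edges, hl]

lemma tf_two_comp {V : Type*} (H : SimpleGraph V) :
    Nat.card H.ConnectedComponent = 2 ↔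
      ∃ u v, ¬ H.Reachable u v ∧ ∀ x, H.Reachable x u ∨ H.Reachable x v := by
  rw [Nat.card_eq_two_iff]
  constructor
  · rintro ⟨c, d, hne, hu⟩
    induction c using ConnectedComponent.ind with | h u
    induction d using ConnectedComponent.ind with | h v
    refine ⟨u, v, fun h => hne (ConnectedComponent.sound h), fun x => ?_⟩
    have : H.connectedComponentMk x ∈ ({H.connectedComponentMk u, H.connectedComponentMk v} : Set _) := by
      rw [hu]; trivial
    rcases this with h | h
    · exact Or.inl (ConnectedComponent.exact h)
    · exact Or.inr (ConnectedComponent.exact h)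
  · rintro ⟨u, v, hn, h⟩
    refine ⟨H.connectedComponentMk u, H.connectedComponentMk v,
      fun h => hn (ConnectedComponent.exact h), ?_⟩
    ext c
    induction c using ConnectedComponent.ind with | h x
    simp only [Set.mem_insert_iff, Set.mem_singleton_iff, Set.mem_univ, iff_true]
    exact (h x).imp ConnectedComponent.sound ConnectedComponent.sound

lemma tf_const {V : Type*} (H : SimpleGraph V) (t : V → Bool)
    (ht : ∀ u v, H.Adj u v → t u = t v) {x y : V} (h : H.Reachable x y) : t x = t y := by
  obtain ⟨p⟩ := h
  induction p with
  | nil => rfl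
  | cons h q ih => exact (ht _ _ h).trans ih

lemma tf_reach_iff {V : Type*} (H : SimpleGraph V) (h2 : Nat.card H.ConnectedComponent = 2)
    (t : V → Bool) (ht : ∀ u v, H.Adj u v → t u = t v) (hne : ∃ p q, t p ≠ t q) (a b : V) :
    H.Reachable a b ↔ t a = t b := by
  obtain ⟨u, v, -, h⟩ := (tf_two_comp H).mp h2
  have htuv : t u ≠ t v := by
    intro he
    obtain ⟨p, q, hpq⟩ := hne
    have key : ∀ z, t z = t u := fun z => by
      rcases h z with h | h
      · exact tf_const H t ht h
      · rw [he]; exact tf_const H t ht h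
    exact hpq ((key p).trans (key q).symm)
  refine ⟨tf_const H t ht, fun hab => ?_⟩
  rcases h a with h1 | h1 <;> rcases h b with h3 | h3
  · exact h1.trans h3.symm
  · exact absurd ((tf_const H t ht h1).symm.trans (hab.trans (tf_const H t ht h3))) htuv
  · exact absurd ((tf_const H t ht h3).symm.trans (hab.symm.trans (tf_const H t ht h1))) htuv
  · exact h1.trans h3.symm

lemma tf_tree_ncard {V : Type*} [Fintype V] (T : SimpleGraph V) (hT : T.IsTree) :
    T.edgeSet.ncard + 1 = Nat.card V := by
  classical
  rw [← hT.card_edgeFinset.trans (Nat.card_eq_fintype_card).symm, ← coe_edgeFinset, Set.ncard_coe_finset]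

lemma tf_tree_of_acyclic {V : Type*} [Fintype V] [Nonempty V] (H : SimpleGraph V)
    (hH : H.IsAcyclic) (hc : H.edgeSet.ncard + 1 = Nat.card V) : H.IsTree := by
  obtain ⟨F, hF1, hF2, hF3⟩ :=
    (connected_top (V := V)).exists_isTree_le_of_le_of_isAcyclic (le_top (a := H)) hH
  have h1 := tf_tree_ncard F hF3
  have : H.edgeSet = F.edgeSet :=
    Set.eq_of_subset_of_ncard_le (edgeSet_mono hF1) (by omega) (Set.toFinite _)
  rw [edgeSet_inj.mp this]
  exact hF3

lemma tf_forest_ncard {V : Type*} [Fintype V] (H : SimpleGraph V)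
    (hH : H.IsAcyclic) (h2 : Nat.card H.ConnectedComponent = 2) :
    H.edgeSet.ncard + 2 = Nat.card V := by
  obtain ⟨u, v, hn, h⟩ := (tf_two_comp H).mp h2
  have hac := hH.sup_edge_of_not_reachable hn
  have huv : u ≠ v := fun h => hn (h ▸ Reachable.refl _)
  have hadj : (H ⊔ edge u v).Adj u v := Or.inr ((edge_adj ..).mpr ⟨Or.inl ⟨rfl, rfl⟩, huv⟩)
  have htree : (H ⊔ edge u v).IsTree := by
    refine ⟨?_, hac⟩
    have : Nonempty V := ⟨u⟩
    have key : ∀ z, (H ⊔ edge u v).Reachable z u := fun z => by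
      rcases h z with h | h
      · exact h.mono le_sup_left
      · exact (h.mono le_sup_left).trans hadj.symm.reachable
    exact Connected.mk (fun p q => (key p).trans (key q).symm)
  have h1 := tf_tree_ncard _ htree
  rw [edgeSet_sup, edgeSet_edge_of_ne huv, Set.union_singleton, Set.ncard_insert_of_notMem] at h1
  · omega
  · intro h
    exact hn (Adj.reachable h)

lemma tf_delete_two_comp {V : Type*} (T : SimpleGraph V) (hT : T.IsTree) (g : Sym2 V)
    (hg : g ∈ T.edgeSet) : Nat.card (T.deleteEdges {g}).ConnectedComponent = 2 := by
  induction g using Sym2.ind with | h u v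
  rw [tf_two_comp]
  refine ⟨u, v, isAcyclic_iff_forall_adj_isBridge.mp hT.isAcyclic hg, fun x => ?_⟩
  obtain ⟨p⟩ := hT.connected x u
  have key : ∀ {x z : V} (p : T.Walk x z), z = u → (T.deleteEdges {s(u, v)}).Reachable x u ∨
      (T.deleteEdges {s(u, v)}).Reachable x v := by
    intro x z p
    induction p with
    | nil => rintro rfl; exact Or.inl (Reachable.refl _)
    | @cons x y z h q ih =>
      intro hz
      by_cases he : s(x, y) = s(u, v)
      · rw [Sym2.eq_iff] at he
        rcases he with ⟨rfl, -⟩ | ⟨rfl, -⟩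
        · exact Or.inl (Reachable.refl _)
        · exact Or.inr (Reachable.refl _)
      · have hadj : (T.deleteEdges {s(u, v)}).Adj x y := by
          rw [deleteEdges_adj]; exact ⟨h, he⟩
        exact (ih hz).imp hadj.reachable.trans hadj.reachable.trans
  exact key p rfl

lemma tf_acyclic {V : Type*} (T : SimpleGraph V) (hT : T.IsTree)
    (s : Sym2 V → V → Bool) (hs : ∀ f u v, T.Adj u v → (s f u ≠ s f v ↔ f = s(u, v)))
    (x y : V) (hn : ¬ T.Adj x y) (f : Sym2 V)
    (hf : f ∈ insert s(x, y) (tfD s x y)) : ((T ⊔ edge x y).deleteEdges {f}).IsAcyclic := by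
  rcases hf with rfl | hf
  · refine hT.isAcyclic.anti ?_
    intro u v h
    simp only [deleteEdges_adj, sup_adj, edge_adj, Set.mem_singleton_iff, Sym2.eq_iff] at h
    tauto
  · have h1 : (T.deleteEdges {f}).IsAcyclic := hT.isAcyclic.anti (deleteEdges_le _)
    have h2 : ¬ (T.deleteEdges {f}).Reachable x y := by
      intro h
      refine hf (tf_const _ (s f) ?_ h)
      intro u v huv
      rw [deleteEdges_adj] at huv
      by_contra h3
      exact huv.2 ((hs f u v huv.1).mp h3).symm
    refine (h1.sup_edge_of_not_reachable h2).anti ?_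
    intro u v h
    simp only [deleteEdges_adj, sup_adj] at h ⊢
    tauto

lemma tf_not_acyclic {V : Type*} (T : SimpleGraph V) (hT : T.IsTree)
    (s : Sym2 V → V → Bool) (hs : ∀ f u v, T.Adj u v → (s f u ≠ s f v ↔ f = s(u, v)))
    (x y : V) (hxy : x ≠ y) (hn : ¬ T.Adj x y) (H : SimpleGraph V) (hH : H.IsAcyclic)
    (he : ∀ e ∈ insert s(x, y) (tfD s x y), e ∈ H.edgeSet) : False := by
  have h0 : H.Adj x y := he _ (Set.mem_insert _ _)
  have hb := isAcyclic_iff_forall_adj_isBridge.mp hH h0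
  refine hb ?_
  obtain ⟨p, hp, hl⟩ := hT.connected.exists_path_of_dist x y
  have hw := tfD_walk T s hs p hp.isTrail
  refine ⟨p.transfer _ ?_⟩
  intro e hep
  rw [edgeSet_deleteEdges]
  refine ⟨he e (Set.mem_insert_of_mem _ ((hw e).mpr hep)), ?_⟩
  rintro rfl
  exact hn (p.edges_subset_edgeSet hep)

/-- The main criterion. -/
lemma tf_crit {V : Type*} [Fintype V] (T : SimpleGraph V) (hT : T.IsTree)
    (s : Sym2 V → V → Bool) (hs : ∀ f u v, T.Adj u v → (s f u ≠ s f v ↔ f = s(u, v)))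
    (x y : V) (hxy : x ≠ y) (hn : ¬ T.Adj x y) (f g : Sym2 V)
    (hf : f ∈ insert s(x, y) (tfD s x y)) (hg : g ∈ (T ⊔ edge x y).edgeSet) (hfg : f ≠ g)
    (a b : V) :
    ((T ⊔ edge x y).deleteEdges {f, g}).IsAcyclic ∧
    Nat.card ((T ⊔ edge x y).deleteEdges {f, g}).ConnectedComponent = 2 ∧
    (¬ ((T ⊔ edge x y).deleteEdges {f, g}).Reachable a b ↔
      Xor (g ∈ tfD s a b) (g ∈ insert s(x, y) (tfD s x y) ∧ f ∈ tfD s a b)) := by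
  classical
  have hac := tf_acyclic T hT s hs x y hn f hf
  have hsub := tfD_sub T hT s hs
  have hES : (T ⊔ edge x y).edgeSet = insert s(x, y) T.edgeSet := by
    rw [edgeSet_sup, edgeSet_edge_of_ne hxy, Set.union_singleton]
  have heT : s(x, y) ∉ T.edgeSet := hn
  have hfG : f ∈ (T ⊔ edge x y).edgeSet := by
    rw [hES]
    exact Set.insert_subset_insert (hsub x y) hf
  have hne : Nonempty V := ⟨x⟩
  have htree : ((T ⊔ edge x y).deleteEdges {f}).IsTree := by
    refine tf_tree_of_acyclic _ hac ?_
    have h1 := tf_tree_ncard T hT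
    have h2 := Set.ncard_sdiff_singleton_add_one hfG (Set.toFinite _)
    rw [edgeSet_deleteEdges]
    have h3 : (T ⊔ edge x y).edgeSet.ncard = T.edgeSet.ncard + 1 := by
      rw [hES, Set.ncard_insert_of_notMem heT]
    omega
  have hdel : (T ⊔ edge x y).deleteEdges {f, g} =
      ((T ⊔ edge x y).deleteEdges {f}).deleteEdges {g} := by
    rw [deleteEdges_deleteEdges]; rfl
  have h2 : Nat.card ((T ⊔ edge x y).deleteEdges {f, g}).ConnectedComponent = 2 := by
    rw [hdel]
    apply tf_delete_two_comp _ htree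
    rw [edgeSet_deleteEdges]
    exact ⟨hg, fun h => hfg h.symm⟩
  refine ⟨?_, h2, ?_⟩
  · rw [hdel]; exact hac.anti (deleteEdges_le _)
  have hs0 : ∀ p q, s s(x, y) p = s s(x, y) q := by
    intro p q
    by_contra h
    exact heT (hsub p q h)
  rw [tf_reach_iff _ h2
    (fun z => if g ∈ insert s(x, y) (tfD s x y) then (s g z ^^ s f z) else s g z)]
  · simp only [tfD, Set.mem_ofPred_eq, Set.mem_insert_iff, Xor]
    split_ifs with h
    · simp only [h, true_and]
      cases s g a <;> cases s g b <;> cases s f a <;> cases s f b <;> decide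
    · simp only [h, false_and]
      tauto
  · intro u v huv
    simp only [deleteEdges_adj, sup_adj, Set.mem_insert_iff, Set.mem_singleton_iff, not_or] at huv
    obtain ⟨h3 | h3, h4, h5⟩ := huv
    · have hf' : s f u = s f v := by
        by_contra h6
        exact h4 ((hs f u v h3).mp h6).symm
      have hg' : s g u = s g v := by
        by_contra h6
        exact h5 ((hs g u v h3).mp h6).symm
      simp only [hf', hg']
    · have h6 : s(u, v) = s(x, y) := by
        rw [edge_adj] at h3
        rw [Sym2.eq_iff]
        exact h3.1
      have hfD : s f x ≠ s f y := hf.resolve_left (fun h => h4 (h6.trans h.symm))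
      have hg0 : g ≠ s(x, y) := fun h => h5 (h6.trans h.symm)
      have key : (if g ∈ insert s(x, y) (tfD s x y) then (s g x ^^ s f x) else s g x) =
        (if g ∈ insert s(x, y) (tfD s x y) then (s g y ^^ s f y) else s g y) := by
        simp only [Set.mem_insert_iff, hg0, false_or, tfD, Set.mem_ofPred_eq]
        revert hfD
        cases s g x <;> cases s g y <;> cases s f x <;> cases s f y <;> decide
      rw [Sym2.eq_iff] at h6
      rcases h6 with ⟨rfl, rfl⟩ | ⟨rfl, rfl⟩
      · exact key
      · exact key.symm
  · by_cases hg0 : g = s(x, y)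
    · refine ⟨x, y, ?_⟩
      have hfD : s f x ≠ s f y := hf.resolve_left (fun h => hfg (h.trans hg0.symm))
      have hgm : g ∈ insert s(x, y) (tfD s x y) := Or.inl hg0
      rw [if_pos hgm, if_pos hgm, hg0, hs0 x y]
      simpa using hfD
    · rw [hES] at hg
      have hgT := hg.resolve_left hg0
      induction g using Sym2.ind with | h u v
      refine ⟨u, v, ?_⟩
      have h3 := (hs s(u, v) u v hgT).mpr rfl
      have h4 : s f u = s f v := by
        by_contra h6
        exact hfg ((hs f u v hgT).mp h6)
      rw [h4]
      split_ifs
      · simpa using h3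
      · exact h3

lemma tf_core {V : Type*} [Fintype V] (T : SimpleGraph V) (hT : T.IsTree)
    (s : Sym2 V → V → Bool) (hs : ∀ f u v, T.Adj u v → (s f u ≠ s f v ↔ f = s(u, v)))
    (x y : V) (hxy : x ≠ y) (hn : ¬ T.Adj x y) (a b : V) :
    (twoTreeForestCount (T ⊔ edge x y) a b : ℤ) =
      ((T.dist x y : ℤ) + 1) * T.dist a b - ((tfD s x y ∩ tfD s a b).ncard : ℤ) ^ 2 := by
  classical
  have hsub := tfD_sub T hT s hs
  have hES : (T ⊔ edge x y).edgeSet = insert s(x, y) T.edgeSet := by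
    rw [edgeSet_sup, edgeSet_edge_of_ne hxy, Set.union_singleton]
  have heT : s(x, y) ∉ T.edgeSet := hn
  have hcrit := tf_crit T hT s hs x y hxy hn
  have hnac := tf_not_acyclic T hT s hs x y hxy hn
  obtain ⟨C, hC⟩ : ∃ C, C = insert s(x, y) (tfD s x y) := ⟨_, rfl⟩
  obtain ⟨P, hP⟩ : ∃ P, P = tfD s a b := ⟨_, rfl⟩
  have hCP : tfD s x y ∩ tfD s a b = C ∩ P := by
    rw [hC, hP, Set.insert_inter_of_notMem]
    exact fun h => heT (hsub a b h)
  have hCc : C.ncard = T.dist x y + 1 := by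
    rw [hC, Set.ncard_insert_of_notMem (fun h => heT (hsub x y h)), tfD_card T hT s hs]
  have hPc : P.ncard = T.dist a b := by rw [hP, tfD_card T hT s hs]
  have hCG : C ⊆ (T ⊔ edge x y).edgeSet := by
    rw [hC, hES]; exact Set.insert_subset_insert (hsub x y)
  have hPG : P ⊆ (T ⊔ edge x y).edgeSet := by
    rw [hP, hES]; exact (hsub a b).trans (Set.subset_insert _ _)
  rw [← hC] at hcrit hnac
  have hset : {H : SimpleGraph V | H ≤ T ⊔ edge x y ∧ H.IsAcyclic ∧
      Nat.card H.ConnectedComponent = 2 ∧ ¬ H.Reachable a b} =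
      (fun q : Sym2 V × Sym2 V => (T ⊔ edge x y).deleteEdges {q.1, q.2}) ''
        ((C \ P) ×ˢ P ∪ (C ∩ P) ×ˢ (P \ C)) := by
    ext H
    constructor
    · rintro ⟨hle, hac, h2, hr⟩
      obtain ⟨f, hfC, hfH⟩ : ∃ f ∈ C, f ∉ H.edgeSet := by
        by_contra! h
        exact hnac H hac h
      have hcard := tf_forest_ncard H hac h2
      have hTc := tf_tree_ncard T hT
      have h3 : (T ⊔ edge x y).edgeSet.ncard = T.edgeSet.ncard + 1 := by
        rw [hES, Set.ncard_insert_of_notMem heT]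
      have h4 := Set.ncard_sdiff_add_ncard_of_subset (edgeSet_mono hle) (Set.toFinite _)
      have h5 : ((T ⊔ edge x y).edgeSet \ H.edgeSet).ncard = 2 := by omega
      obtain ⟨g, hfg, hdiff⟩ : ∃ g, f ≠ g ∧ (T ⊔ edge x y).edgeSet \ H.edgeSet = {f, g} := by
        obtain ⟨p, q, hpq, h⟩ := Set.ncard_eq_two.mp h5
        have : f ∈ ({p, q} : Set (Sym2 V)) := h ▸ ⟨hCG hfC, hfH⟩
        rcases this with rfl | h'
        · exact ⟨q, hpq, h⟩
        · have h' : f = q := h'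
          subst h'
          exact ⟨p, hpq.symm, by rw [h, Set.pair_comm]⟩
      have hgd : g ∈ (T ⊔ edge x y).edgeSet \ H.edgeSet := by rw [hdiff]; simp
      have hH : H = (T ⊔ edge x y).deleteEdges {f, g} := by
        rw [← edgeSet_inj, edgeSet_deleteEdges, ← hdiff, Set.sdiff_sdiff_cancel_left (edgeSet_mono hle)]
      have h6 := (hcrit f g hfC hgd.1 hfg a b).2.2
      rw [← hH, ← hP] at h6
      have h7 := h6.mp hr
      have hpair : H = (T ⊔ edge x y).deleteEdges {g, f} := by rw [hH, Set.pair_comm]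
      rcases h7 with ⟨hgP, h8⟩ | ⟨⟨hgC, hfP⟩, hgP⟩
      · by_cases hfP : f ∈ P
        · exact ⟨(f, g), Or.inr ⟨⟨hfC, hfP⟩, hgP, fun h => h8 ⟨h, hfP⟩⟩, hH.symm⟩
        · exact ⟨(f, g), Or.inl ⟨⟨hfC, hfP⟩, hgP⟩, hH.symm⟩
      · exact ⟨(g, f), Or.inl ⟨⟨hgC, hgP⟩, hfP⟩, hpair.symm⟩
    · rintro ⟨⟨f, g⟩, hq, rfl⟩
      simp only [Set.mem_union, Set.mem_prod, Set.mem_sdiff, Set.mem_inter_iff] at hq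
      have hfC : f ∈ C := hq.elim (fun h => h.1.1) (fun h => h.1.1)
      have hgP : g ∈ P := hq.elim (fun h => h.2) (fun h => h.2.1)
      have hfg : f ≠ g := by
        rintro rfl
        exact hq.elim (fun h => h.1.2 h.2) (fun h => h.2.2 h.1.1)
      obtain ⟨h1, h2, h3⟩ := hcrit f g hfC (hPG hgP) hfg a b
      refine ⟨deleteEdges_le _, h1, h2, h3.mpr ?_⟩
      rw [← hP]
      exact Or.inl ⟨hgP, fun h => hq.elim (fun h' => h'.1.2 h.2) (fun h' => h'.2.2 h.1)⟩
  have hinj : Set.InjOn (fun q : Sym2 V × Sym2 V => (T ⊔ edge x y).deleteEdges {q.1, q.2})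
        ((C \ P) ×ˢ P ∪ (C ∩ P) ×ˢ (P \ C)) := by
    rintro ⟨f, g⟩ hq ⟨f', g'⟩ hq' heq
    simp only [Set.mem_union, Set.mem_prod, Set.mem_sdiff, Set.mem_inter_iff] at hq hq'
    have hsb : ∀ f g, f ∈ C → g ∈ P → ({f, g} : Set (Sym2 V)) ⊆ (T ⊔ edge x y).edgeSet := by
      rintro f g hf hg e (rfl | h)
      · exact hCG hf
      · rw [Set.mem_singleton_iff.mp h]; exact hPG hg
    have h1 : ({f, g} : Set (Sym2 V)) = {f', g'} := by
      have := congrArg SimpleGraph.edgeSet heq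
      simp only [edgeSet_deleteEdges] at this
      rw [← Set.sdiff_sdiff_cancel_left (hsb f g (hq.elim (fun h => h.1.1) (fun h => h.1.1))
          (hq.elim (fun h => h.2) (fun h => h.2.1))), this,
        Set.sdiff_sdiff_cancel_left (hsb f' g' (hq'.elim (fun h => h.1.1) (fun h => h.1.1))
          (hq'.elim (fun h => h.2) (fun h => h.2.1)))]
    rcases Set.pair_eq_pair_iff.mp h1 with ⟨rfl, rfl⟩ | ⟨rfl, rfl⟩
    · rfl
    · exfalso
      clear * - hq hq'
      tauto
  unfold twoTreeForestCount
  rw [hset, Set.ncard_image_of_injOn hinj, Set.ncard_union_eq _ (Set.toFinite _) (Set.toFinite _),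
    Set.ncard_prod, Set.ncard_prod, hCP]
  · have e1 := Set.ncard_inter_add_ncard_diff_eq_ncard C P (Set.toFinite _)
    have e2 := Set.ncard_inter_add_ncard_diff_eq_ncard P C (Set.toFinite _)
    rw [Set.inter_comm] at e2
    rw [hPc] at e2 ⊢
    rw [hCc] at e1
    zify at e1 e2
    push_cast
    rw [← e1, ← e2]
    ring
  · rw [Set.disjoint_left]
    rintro ⟨f, g⟩ h1 h2
    simp only [Set.mem_prod, Set.mem_sdiff, Set.mem_inter_iff] at h1 h2
    exact h1.1.2 h2.1.2

theorem two_forest_count_formula {V : Type*} [Fintype V]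
    (T : SimpleGraph V) (hT : T.IsTree) (c : ℕ) (hc : 3 ≤ c)
    (w : Fin c → V) (hw : Function.Injective w)
    (hpath : ∀ i : Fin c, ∀ h : (i : ℕ) + 1 < c, T.Adj (w i) (w ⟨(i : ℕ) + 1, h⟩))
    (G : SimpleGraph V)
    (hG : G = T ⊔ SimpleGraph.fromEdgeSet {s(w ⟨0, by omega⟩, w ⟨c - 1, by omega⟩)})
    (a b : V) (j k : Fin c)
    (ha : ∀ i : Fin c, T.dist a (w i) = T.dist a (w j) + T.dist (w j) (w i))
    (hb : ∀ i : Fin c, T.dist b (w i) = T.dist b (w k) + T.dist (w k) (w i)) :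
    (twoTreeForestCount G a b : ℤ)
      = (c : ℤ) * (T.dist a b : ℤ) - (((j:ℕ) : ℤ) - ((k:ℕ) : ℤ)) ^ 2 := by
  classical
  obtain ⟨s, hs⟩ := tf_exists_side T hT
  have hcardD := tfD_card T hT s hs
  -- separating edges along the path
  have hD : ∀ (i : ℕ) (hi : i < c) (l : ℕ) (hl : l < c), i ≤ l →
      ∀ f, f ∈ tfD s (w ⟨i, hi⟩) (w ⟨l, hl⟩) ↔
        ∃ (t : ℕ) (ht : t + 1 < c), i ≤ t ∧ t < l ∧ f = s(w ⟨t, by omega⟩, w ⟨t + 1, ht⟩) := by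
    intro i hi l
    induction l with
    | zero =>
      intro hl hil f
      have : i = 0 := by omega
      subst this
      simp [tfD]
    | succ l ih =>
      intro hl hil f
      rcases Nat.eq_or_lt_of_le hil with rfl | hlt
      · simp only [tfD, Set.mem_ofPred_eq, ne_eq, not_true_eq_false, false_iff]
        rintro ⟨t, ht, h1, h2, -⟩
        omega
      have h1 := ih (by omega) (by omega) f
      have h2 : s f (w ⟨l, by omega⟩) ≠ s f (w ⟨l + 1, hl⟩) ↔
          f = s(w ⟨l, by omega⟩, w ⟨l + 1, hl⟩) := hs f _ _ (hpath ⟨l, by omega⟩ hl)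
      have h3 : f ∈ tfD s (w ⟨i, hi⟩) (w ⟨l, by omega⟩) →
          f ≠ s(w ⟨l, by omega⟩, w ⟨l + 1, hl⟩) := by
        rw [h1]
        rintro ⟨t, ht, h4, h5, rfl⟩ heq
        rw [Sym2.eq_iff] at heq
        simp only [hw.eq_iff, Fin.mk.injEq] at heq
        omega
      have h4 : (∃ (t : ℕ) (ht : t + 1 < c), i ≤ t ∧ t < l + 1 ∧
            f = s(w ⟨t, by omega⟩, w ⟨t + 1, ht⟩)) ↔
          (∃ (t : ℕ) (ht : t + 1 < c), i ≤ t ∧ t < l ∧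
            f = s(w ⟨t, by omega⟩, w ⟨t + 1, ht⟩)) ∨
            f = s(w ⟨l, by omega⟩, w ⟨l + 1, hl⟩) := by
        constructor
        · rintro ⟨t, ht, h5, h6, h7⟩
          rcases Nat.lt_succ_iff_lt_or_eq.mp h6 with h8 | rfl
          · exact Or.inl ⟨t, ht, h5, h8, h7⟩
          · exact Or.inr h7
        · rintro (⟨t, ht, h5, h6, h7⟩ | h)
          · exact ⟨t, ht, h5, by omega, h7⟩
          · exact ⟨l, hl, by omega, by omega, h⟩
      rw [h4, ← h1, ← h2]
      rw [ne_eq, ← h2] at h3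
      simp only [tfD, Set.mem_ofPred_eq] at h3 ⊢
      revert h3
      cases s f (w ⟨i, hi⟩) <;> cases s f (w ⟨l, by omega⟩) <;>
        cases s f (w ⟨l + 1, hl⟩) <;> decide
  have hDc : ∀ (i : ℕ) (hi : i < c) (l : ℕ) (hl : l < c), i ≤ l →
      (tfD s (w ⟨i, hi⟩) (w ⟨l, hl⟩)).ncard = l - i := by
    intro i hi l hl hil
    let e : ℕ → Sym2 V := fun t => if ht : t + 1 < c then s(w ⟨t, by omega⟩, w ⟨t + 1, ht⟩)
      else s(w ⟨0, by omega⟩, w ⟨0, by omega⟩)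
    have : tfD s (w ⟨i, hi⟩) (w ⟨l, hl⟩) = e '' (Finset.Ico i l : Set ℕ) := by
      ext f
      rw [hD i hi l hl hil]
      simp only [Set.mem_image, Finset.coe_Ico, Set.mem_Ico]
      constructor
      · rintro ⟨t, ht, h1, h2, rfl⟩
        exact ⟨t, ⟨h1, h2⟩, dif_pos ht⟩
      · rintro ⟨t, ⟨h1, h2⟩, rfl⟩
        exact ⟨t, by omega, h1, h2, dif_pos _⟩
    rw [this, Set.ncard_image_of_injOn, Set.ncard_coe_finset, Nat.card_Ico]
    intro t ht t' ht' heq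
    simp only [Finset.coe_Ico, Set.mem_Ico] at ht ht'
    simp only [e] at heq
    rw [dif_pos (by omega), dif_pos (by omega), Sym2.eq_iff] at heq
    simp only [hw.eq_iff, Fin.mk.injEq] at heq
    omega
  have hsym : ∀ p q, tfD s p q = tfD s q p := fun p q => by
    ext f; exact ne_comm
  set x := w ⟨0, by omega⟩ with hx
  set y := w ⟨c - 1, by omega⟩ with hy
  have hdxy : T.dist x y = c - 1 := by
    rw [← hcardD, hx, hy, hDc _ _ _ _ (by omega)]; omega
  have hxy : x ≠ y := by
    intro h
    rw [h, SimpleGraph.dist_self] at hdxy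
    omega
  have hn : ¬ T.Adj x y := by
    intro h
    rw [dist_eq_one_iff_adj.mpr h] at hdxy
    omega
  have hGe : G = T ⊔ edge x y := hG
  -- disjointness
  have hdisj : ∀ (z : V) (l : Fin c),
      (∀ i : Fin c, T.dist z (w i) = T.dist z (w l) + T.dist (w l) (w i)) →
      ∀ i f, f ∈ tfD s (w l) (w i) → f ∉ tfD s z (w l) := by
    intro z l hz i f h1 h2
    have h3 := hz i
    rw [← hcardD, ← hcardD, ← hcardD] at h3
    have h4 : tfD s z (w i) ⊆ (tfD s z (w l) ∪ tfD s (w l) (w i)) \ {f} := by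
      intro g hg
      simp only [tfD, Set.mem_ofPred_eq, Set.mem_sdiff, Set.mem_union, Set.mem_singleton_iff]
        at hg h1 h2 ⊢
      constructor
      · by_contra! h
        exact hg (h.1.trans h.2)
      · rintro rfl
        revert hg h1 h2
        cases s g z <;> cases s g (w l) <;> cases s g (w i) <;> decide
    have h5 := Set.ncard_le_ncard h4 (Set.toFinite _)
    have h6 := Set.ncard_sdiff_singleton_lt_of_mem (s := tfD s z (w l) ∪ tfD s (w l) (w i))
      (Or.inl h2) (Set.toFinite _)
    have h7 := Set.ncard_union_le (tfD s z (w l)) (tfD s (w l) (w i))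
    omega
  have hdisj2 : ∀ (z : V) (l : Fin c),
      (∀ i : Fin c, T.dist z (w i) = T.dist z (w l) + T.dist (w l) (w i)) →
      ∀ f ∈ tfD s x y, s f z = s f (w l) := by
    intro z l hz f hf
    by_contra h
    have h1 := hdisj z l hz ⟨0, by omega⟩ f
    have h2 := hdisj z l hz ⟨c - 1, by omega⟩ f
    have h3 : s f (w l) = s f x := by
      by_contra h4
      exact h1 h4 h
    have h4 : s f (w l) = s f y := by
      by_contra h4
      exact h2 h4 h
    exact hf (h3.symm.trans h4)
  have hsubset : ∀ i l : Fin c, i ≤ l → tfD s (w i) (w l) ⊆ tfD s x y := by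
    intro i l hil f hf
    obtain ⟨t, ht, h1, h2, h3⟩ := (hD i i.2 l l.2 hil f).mp hf
    exact (hD 0 (by omega) (c - 1) (by omega) (by omega) f).mpr ⟨t, ht, by omega, by omega, h3⟩
  have hsubset' : ∀ i l : Fin c, tfD s (w i) (w l) ⊆ tfD s x y := by
    intro i l
    rcases le_total i l with h | h
    · exact hsubset i l h
    · rw [hsym]; exact hsubset l i h
  have hint : tfD s x y ∩ tfD s a b = tfD s (w j) (w k) := by
    ext f
    constructor
    · rintro ⟨h1, h2⟩
      have := hdisj2 a j ha f h1
      have := hdisj2 b k hb f h1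
      simp only [tfD, Set.mem_ofPred_eq] at h2 ⊢
      simp_all
    · intro h
      have h1 := hsubset' j k h
      refine ⟨h1, ?_⟩
      have := hdisj2 a j ha f h1
      have := hdisj2 b k hb f h1
      simp only [tfD, Set.mem_ofPred_eq] at h ⊢
      simp_all
  rw [hGe, tf_core T hT s hs x y hxy hn a b, hint, hdxy]
  have e1 : ((c - 1 : ℕ) : ℤ) + 1 = c := by omega
  rw [e1]
  congr 1
  rcases le_total j k with h | h
  · have := hDc j j.2 k k.2 h
    have h' : (j : ℕ) ≤ k := h
    rw [show (tfD s (w j) (w k)).ncard = (k : ℕ) - j from this, Nat.cast_sub h']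
    ring
  · have := hDc k k.2 j j.2 h
    have h' : (k : ℕ) ≤ j := h
    rw [hsym, show (tfD s (w k) (w j)).ncard = (j : ℕ) - k from this, Nat.cast_sub h']
end
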